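/- Let X_t be the symmetric decoherent Hadamard walk on the line with 0 < p ≤ 1 and q = 1 − p, and set v = (p + 2√(1+q²) − 2)/p. Then for every fixed real k the characteristic function satisfies P̂(k/√t, t) = exp(−(v/2)k²) + O(t^{−1}) as t → ∞ (i.e., for each k there are constants C > 0 and T such that |P̂(k/√t, t) − exp(−(v/2)k²)| ≤ C/t for all t ≥ T); consequently X_t/√t converges in distribution to the centered Gaussian law N(0, v). -/

import Mathlib

noncomputable section

open Complex Filter

/-- Amplitude functions on the position × coin space `ℤ × {1,2}`
(coin `0` = "right", coin `1` = "left"). -/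
abbrev QState := ℤ × Fin 2 → ℂ

/-- One step of the Hadamard walk: `(hadamardStep ψ) (x,n) = ⟨x,n|U ψ⟩`, where `U = S ∘ C`
with `S` the chirality-conditioned shift and `C` the Hadamard coin. -/
def hadamardStep (ψ : QState) : QState := fun v =>
  if v.2 = 0 then (ψ (v.1 - 1, 0) + ψ (v.1 - 1, 1)) / (Real.sqrt 2 : ℂ)
  else (ψ (v.1 + 1, 0) - ψ (v.1 + 1, 1)) / (Real.sqrt 2 : ℂ)

/-- The basis state `|x,n⟩`. -/
def ket (x : ℤ) (n : Fin 2) : QState := fun v => if v = (x, n) then 1 else 0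

/-- Pure Hadamard-walk probabilities `W_{m,n}(x,t) = |⟨x,n|U^t|0,m⟩|²`. -/
def W (m n : Fin 2) (x : ℤ) (t : ℕ) : ℝ := ‖(hadamardStep^[t] (ket 0 m)) (x, n)‖ ^ 2

/-- Measurement operators, indexed by `𝔸 = {c} ∪ ℤ×{1,2}`:
`none` is the coherent projection `A_c = √(1-p)·I`, and `some (x,n)` is the
decoherence projection `A_{x,n} = √p |x,n⟩⟨x,n|`. -/
def measOp (p : ℝ) : Option (ℤ × Fin 2) → QState → QState
  | none => fun ψ v => (Real.sqrt (1 - p) : ℂ) * ψ v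
  | some w => fun ψ v => if v = w then (Real.sqrt p : ℂ) * ψ w else 0

/-- The amplitude `(A_{j_t}U)⋯(A_{j_1}U)|0,m⟩` along the path `j`. -/
def pathAmp (p : ℝ) (m : Fin 2) : (t : ℕ) → (Fin t → Option (ℤ × Fin 2)) → QState
  | 0, _ => ket 0 m
  | t + 1, j => measOp p (j (Fin.last t)) (hadamardStep (pathAmp p m t fun i => j i.castSucc))

/-- Decoherent Hadamard-walk probabilities
`P_{m,n}(x,t) = Σ_{j∈𝔸^t} |⟨x,n|(A_{j_t}U)⋯(A_{j_1}U)|0,m⟩|²`. -/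
def Pdec (p : ℝ) (m n : Fin 2) (x : ℤ) (t : ℕ) : ℝ :=
  ∑' j : Fin t → Option (ℤ × Fin 2), ‖pathAmp p m t j (x, n)‖ ^ 2

/-- `Ŵ_{m,n}(k,t) = Σ_x W_{m,n}(x,t) e^{ikx}`. -/
def What (m n : Fin 2) (k : ℝ) (t : ℕ) : ℂ :=
  ∑' x : ℤ, (W m n x t : ℂ) * Complex.exp (Complex.I * k * x)

/-- `P̂_{m,n}(k,z) = Σ_{t≥0} Σ_x P_{m,n}(x,t) e^{ikx} z^t`. -/
def Phat (p : ℝ) (m n : Fin 2) (k : ℝ) (z : ℂ) : ℂ :=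
  ∑' t : ℕ, (∑' x : ℤ, (Pdec p m n x t : ℂ) * Complex.exp (Complex.I * k * x)) * z ^ t

/-- `Q̂_{m,n}(k,z) = (p/q) Σ_{t≥1} Ŵ_{m,n}(k,t) (qz)^t = p Σ_{t≥1} Ŵ_{m,n}(k,t) q^{t-1} z^t`
with `q = 1-p`. -/
def Qhat (p : ℝ) (m n : Fin 2) (k : ℝ) (z : ℂ) : ℂ :=
  (p : ℂ) * ∑' t : ℕ, What m n k (t + 1) * ((1 - p : ℝ) : ℂ) ^ t * z ^ (t + 1)

/-- The matrix `P(k,z) = (P̂_{m,n}(k,z))`. -/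
def Pmat (p k : ℝ) (z : ℂ) : Matrix (Fin 2) (Fin 2) ℂ := Matrix.of fun m n => Phat p m n k z

/-- The matrix `Q(k,z) = (Q̂_{m,n}(k,z))`. -/
def Qmat (p k : ℝ) (z : ℂ) : Matrix (Fin 2) (Fin 2) ℂ := Matrix.of fun m n => Qhat p m n k z

/-- Maximum row-sum norm of a 2×2 complex matrix. -/
def rowSumNorm (A : Matrix (Fin 2) (Fin 2) ℂ) : ℝ :=
  max (‖A 0 0‖ + ‖A 0 1‖) (‖A 1 0‖ + ‖A 1 1‖)

/-- Distribution of the symmetric decoherent Hadamard walk: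
`P(X_t = x) = (1/2) Σ_{m,n} P_{m,n}(x,t)`. -/
def PsymProb (p : ℝ) (x : ℤ) (t : ℕ) : ℝ := (1/2) * ∑ m : Fin 2, ∑ n : Fin 2, Pdec p m n x t

/-- Mean position of the symmetric decoherent walk. -/
def symMean (p : ℝ) (t : ℕ) : ℝ := ∑' x : ℤ, (x : ℝ) * PsymProb p x t

/-- Variance of the symmetric decoherent walk. -/
def symVar (p : ℝ) (t : ℕ) : ℝ :=
  (∑' x : ℤ, (x : ℝ) ^ 2 * PsymProb p x t) - (∑' x : ℤ, (x : ℝ) * PsymProb p x t) ^ 2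

/-- The symmetric generating function `P̂(k,z) = (1/2) Σ_{m,n} P̂_{m,n}(k,z)`. -/
def PhatSym (p k : ℝ) (z : ℂ) : ℂ := (1/2) * ∑ m : Fin 2, ∑ n : Fin 2, Phat p m n k z

/-- Characteristic function `P̂(k,t)` of the symmetric decoherent walk. -/
def charSym (p k : ℝ) (t : ℕ) : ℂ :=
  ∑' x : ℤ, (PsymProb p x t : ℂ) * Complex.exp (Complex.I * k * x)

/-- Distribution of the decoherent walk started at `|0,1⟩`: `P(X̃_t = x) = Σ_n P_{1,n}(x,t)`. -/
def Ptilde (p : ℝ) (x : ℤ) (t : ℕ) : ℝ := ∑ n : Fin 2, Pdec p 0 n x t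

/-- Mean position of the decoherent walk started at `|0,1⟩`. -/
def tildeMean (p : ℝ) (t : ℕ) : ℝ := ∑' x : ℤ, (x : ℝ) * Ptilde p x t

/-- Variance of the decoherent walk started at `|0,1⟩`. -/
def tildeVar (p : ℝ) (t : ℕ) : ℝ :=
  (∑' x : ℤ, (x : ℝ) ^ 2 * Ptilde p x t) - (∑' x : ℤ, (x : ℝ) * Ptilde p x t) ^ 2

/-- Characteristic function of the decoherent walk started at `|0,1⟩`. -/
def charTilde (p k : ℝ) (t : ℕ) : ℂ :=
  ∑' x : ℤ, (Ptilde p x t : ℂ) * Complex.exp (Complex.I * k * x)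

/-- The symmetric initial state `φ₀ = (|0,1⟩ + i|0,2⟩)/√2`. -/
def phi0 : QState := fun v =>
  if v = ((0 : ℤ), (0 : Fin 2)) then (1 / Real.sqrt 2 : ℂ)
  else if v = ((0 : ℤ), (1 : Fin 2)) then Complex.I / Real.sqrt 2 else 0

/-- Distribution of the pure symmetric Hadamard walk: `P(Q_t = x) = Σ_n |⟨x,n|U^t|φ₀⟩|²`. -/
def Ppure (x : ℤ) (t : ℕ) : ℝ := ∑ n : Fin 2, ‖(hadamardStep^[t] phi0) (x, n)‖ ^ 2

/-- Variance of the pure symmetric Hadamard walk. -/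
def pureVar (t : ℕ) : ℝ :=
  (∑' x : ℤ, (x : ℝ) ^ 2 * Ppure x t) - (∑' x : ℤ, (x : ℝ) * Ppure x t) ^ 2

/-- `E(k,z) = √((q²z² − (1+cos k)qz + 1)(q²z² + (1+cos k)qz + 1))`, principal branch. -/
def Efun (q k : ℝ) (z : ℂ) : ℂ :=
  (((q : ℂ) ^ 2 * z ^ 2 - (1 + (Real.cos k : ℂ)) * (q : ℂ) * z + 1) *
    ((q : ℂ) ^ 2 * z ^ 2 + (1 + (Real.cos k : ℂ)) * (q : ℂ) * z + 1)) ^ ((1 : ℂ) / 2)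

open scoped ComplexConjugate

/-- The density kernel of the decoherent walk started at `|0,m⟩`: coherent evolution, followed by
damping of the off-diagonal entries. -/
def densityKernel (p : ℝ) (m : Fin 2) : ℕ → ℤ × Fin 2 → ℤ × Fin 2 → ℂ
  | 0 => fun v w => ket 0 m v * conj (ket 0 m w)
  | t + 1 => fun v w => (if v = w then 1 else ((1 - p : ℝ) : ℂ)) *
      hadamardStep (fun v' => hadamardStep (fun w' => densityKernel p m t v' w') w) v

lemma hasSum_hadamardStep {J : Type*} {ψ : J → QState} {φ : QState}
    (h : ∀ v, HasSum (fun j => ψ j v) (φ v)) (v : ℤ × Fin 2) :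
    HasSum (fun j => hadamardStep (ψ j) v) (hadamardStep φ v) := by
  unfold hadamardStep
  split_ifs
  · exact ((h _).add (h _)).div_const _
  · exact ((h _).sub (h _)).div_const _

lemma hadamardStep_mul_conj (ψ : QState) (v w : ℤ × Fin 2) :
    hadamardStep (fun v' => hadamardStep (fun w' => ψ v' * conj (ψ w')) w) v =
      hadamardStep ψ v * conj (hadamardStep ψ w) := by
  unfold hadamardStep
  split_ifs <;> simp only [map_div₀, map_add, map_sub, Complex.conj_ofReal] <;> ring

lemma hasSum_ite_last {α : Type*} [DecidableEq α] {t : ℕ} (a : α) {g : (Fin t → α) → ℂ} {s : ℂ}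
    (h : HasSum g s) :
    HasSum (fun j : Fin (t + 1) → α =>
      if j (Fin.last t) = a then g (fun i => j i.castSucc) else 0) s := by
  have hinj : Function.Injective
      (fun j : Fin t → α => (Fin.snoc j a : Fin (t + 1) → α)) := by
    intro j j' hj
    funext i
    have := congrFun hj i.castSucc
    simpa using this
  rw [← hinj.hasSum_iff]
  · simpa [Function.comp_def] using h
  · intro j hj
    rw [if_neg]
    rintro rfl
    exact hj ⟨fun i => j i.castSucc, Fin.snoc_init_self j⟩

lemma hasSum_pathAmp_mul_conj {p : ℝ} (hp0 : 0 ≤ p) (hp1 : p ≤ 1) (m : Fin 2) (t : ℕ)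
    (v w : ℤ × Fin 2) :
    HasSum (fun j : Fin t → Option (ℤ × Fin 2) => pathAmp p m t j v * conj (pathAmp p m t j w))
      (densityKernel p m t v w) := by
  induction t generalizing v w with
  | zero => simp [pathAmp, densityKernel]
  | succ t ih =>
    have key : HasSum (fun j : Fin t → Option (ℤ × Fin 2) =>
        hadamardStep (pathAmp p m t j) v * conj (hadamardStep (pathAmp p m t j) w))
        (hadamardStep (fun v' => hadamardStep (fun w' => densityKernel p m t v' w') w) v) := by
      have h := hasSum_hadamardStep (fun v' => hasSum_hadamardStep (fun w' => ih v' w') w) v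
      simpa only [hadamardStep_mul_conj] using h
    have hsq : ∀ x : ℝ, 0 ≤ x → (Real.sqrt x : ℂ) * (Real.sqrt x : ℂ) = (x : ℂ) := by
      intro x hx
      rw [← Complex.ofReal_mul, Real.mul_self_sqrt hx]
    have h1 := hasSum_ite_last (none : Option (ℤ × Fin 2)) (key.mul_left ((1 - p : ℝ) : ℂ))
    have h2 := hasSum_ite_last (some v : Option (ℤ × Fin 2))
      (key.mul_left (if v = w then (p : ℂ) else 0))
    convert! h1.add h2 using 1
    · funext j
      simp only [pathAmp]
      rcases hj : j (Fin.last t) with _ | z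
      · simp only [measOp, map_mul, Complex.conj_ofReal, if_true, reduceCtorEq, if_false, add_zero]
        rw [← hsq (1 - p) (by linarith)]
        ring
      · by_cases hvw : v = w
        · subst hvw
          by_cases hz : v = z
          · subst hz
            simp only [measOp, map_mul, Complex.conj_ofReal, if_true, reduceCtorEq, if_false,
              zero_add]
            rw [← hsq p hp0]
            ring
          · simp [measOp, hz, Ne.symm hz]
        · by_cases hz : v = z
          · subst hz
            simp [measOp, hvw, Ne.symm hvw]
          · simp [measOp, hz, Ne.symm hz]
    · simp only [densityKernel]
      split_ifs <;> push_cast <;> ring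

lemma ofReal_Pdec {p : ℝ} (hp0 : 0 ≤ p) (hp1 : p ≤ 1) (m n : Fin 2) (x : ℤ) (t : ℕ) :
    (Pdec p m n x t : ℂ) = densityKernel p m t (x, n) (x, n) := by
  rw [← (hasSum_pathAmp_mul_conj hp0 hp1 m t (x, n) (x, n)).tsum_eq, Pdec, Complex.ofReal_tsum]
  refine tsum_congr fun j => ?_
  rw [Complex.mul_conj, Complex.normSq_eq_norm_sq]

/-- The fibre at momentum `k` of a density kernel, as a function of half the relative coordinate,
in the matrix form `[[ι + iζ, iu], [iw, ι - iζ]]`. -/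
structure FibreState where
  ι : ℤ → ℝ
  ζ : ℤ → ℝ
  u : ℤ → ℝ
  w : ℤ → ℝ

/-- The damping factor of the diagonal coin entries at relative coordinate `2d`. -/
def damping (q : ℝ) (d : ℤ) : ℝ := if d = 0 then 1 else q

/-- One step of the decoherent walk on the fibre at momentum `k`. -/
def FibreState.step (q k : ℝ) (S : FibreState) : FibreState where
  ι d := damping q d * (Real.cos k * S.ι d - Real.sin k * ((S.u d + S.w d) / 2))
  ζ d := damping q d * (Real.cos k * ((S.u d + S.w d) / 2) + Real.sin k * S.ι d)
  u d := q * (S.ζ (d - 1) - (S.u (d - 1) - S.w (d - 1)) / 2)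
  w d := q * (S.ζ (d + 1) + (S.u (d + 1) - S.w (d + 1)) / 2)

/-- The state at time `t`, started from the identity coin matrix at relative coordinate `0`. -/
def fibre (q k : ℝ) : ℕ → FibreState
  | 0 => ⟨fun d => if d = 0 then 1 else 0, 0, 0, 0⟩
  | t + 1 => (fibre q k t).step q k

/-- The entry of the momentum-`k` fibre of the unnormalized symmetric walk, before summation over
the centre of mass coordinate `y`. -/
def fibreTerm (p k : ℝ) (t : ℕ) (d : ℤ) (n n' : Fin 2) (y : ℤ) : ℂ :=
  (densityKernel p 0 t (y + d, n) (y - d, n') + densityKernel p 1 t (y + d, n) (y - d, n')) *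
    Complex.exp (Complex.I * k * y)

lemma inv_sqrt_two_mul_self : ((Real.sqrt 2 : ℝ) : ℂ)⁻¹ * ((Real.sqrt 2 : ℝ) : ℂ)⁻¹ = 1 / 2 := by
  rw [← mul_inv, ← Complex.ofReal_mul, Real.mul_self_sqrt (by norm_num)]
  norm_num

lemma hasSum_fibreTerm (p k : ℝ) (t : ℕ) (d : ℤ) :
    HasSum (fibreTerm p k t d 0 0)
        ((fibre (1 - p) k t).ι d + Complex.I * (fibre (1 - p) k t).ζ d) ∧
      HasSum (fibreTerm p k t d 1 1)
        ((fibre (1 - p) k t).ι d - Complex.I * (fibre (1 - p) k t).ζ d) ∧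
      HasSum (fibreTerm p k t d 0 1) (Complex.I * (fibre (1 - p) k t).u d) ∧
      HasSum (fibreTerm p k t d 1 0) (Complex.I * (fibre (1 - p) k t).w d) := by
  induction t generalizing d with
  | zero =>
    have hd : ∀ n : Fin 2, HasSum (fibreTerm p k 0 d n n) (if d = 0 then 1 else 0) := by
      intro n
      have h := hasSum_ite_eq (0 : ℤ) (if d = 0 then (1 : ℂ) else 0)
      convert! h using 1
      funext y
      by_cases hy : y = 0 <;> by_cases hd : d = 0 <;> fin_cases n <;>
        simp [fibreTerm, densityKernel, ket, hy, hd] <;> omega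
    refine ⟨?_, ?_, ?_, ?_⟩
    · simpa [fibre, apply_ite] using hd 0
    · simpa [fibre, apply_ite] using hd 1
    · convert! hasSum_zero using 1
      · funext y
        simp [fibreTerm, densityKernel, ket]
      · simp [fibre]
    · convert! hasSum_zero using 1
      · funext y
        simp [fibreTerm, densityKernel, ket]
      · simp [fibre]
  | succ t ih =>
    set q : ℂ := ((1 - p : ℝ) : ℂ) with hq
    have hcs : Complex.exp (Complex.I * k) = Real.cos k + Complex.I * Real.sin k := by
      rw [mul_comm, Complex.exp_mul_I, Complex.ofReal_cos, Complex.ofReal_sin]; ring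
    have hcs' : Complex.exp (-(Complex.I * k)) = Real.cos k - Complex.I * Real.sin k := by
      rw [show -(Complex.I * k) = (-k : ℂ) * Complex.I by ring, Complex.exp_mul_I, Complex.cos_neg,
        Complex.sin_neg, Complex.ofReal_cos, Complex.ofReal_sin]; ring
    have hI := Complex.I_mul_I
    have hdamp : ((damping (1 - p) d : ℝ) : ℂ) = if d = 0 then 1 else q := by
      unfold damping; split_ifs <;> simp [hq]
    have hs2 := inv_sqrt_two_mul_self
    refine ⟨?_, ?_, ?_, ?_⟩
    · obtain ⟨h00, h11, h01, h10⟩ := ih d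
      have h := ((h00.add h01).add (h10.add h11)).mul_left
        ((if d = 0 then 1 else q) * Complex.exp (Complex.I * k) * (1 / 2))
      rw [← (Equiv.addRight (-1 : ℤ)).hasSum_iff] at h
      convert! h using 1
      · funext y
        have he : Complex.exp (Complex.I * k * y) =
            Complex.exp (Complex.I * k) * Complex.exp (Complex.I * k * ((y + -1 : ℤ) : ℂ)) := by
          rw [← Complex.exp_add]; push_cast; ring_nf
        have hc : ((y + d, (0 : Fin 2)) = (y - d, (0 : Fin 2))) ↔ d = 0 := by
          simp; omega
        have e1 : y + d - 1 = y + -1 + d := by ring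
        have e2 : y - d - 1 = y + -1 - d := by ring
        simp only [Function.comp, Equiv.coe_addRight, fibreTerm, densityKernel, hadamardStep, hc,
          he, e1, e2, ← hq, if_true, div_eq_mul_inv _ ((Real.sqrt 2 : ℝ) : ℂ)]
        rw [← hs2]
        ring
      · simp only [fibre, FibreState.step, Complex.ofReal_mul, hdamp, hcs]
        push_cast
        linear_combination (-(1 / 2) * (if d = 0 then 1 else q) * Complex.sin k *
          ((fibre (1 - p) k t).u d + (fibre (1 - p) k t).w d)) * hI
    · obtain ⟨h00, h11, h01, h10⟩ := ih d
      have h := ((h00.sub h01).add (h11.sub h10)).mul_left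
        ((if d = 0 then 1 else q) * Complex.exp (-(Complex.I * k)) * (1 / 2))
      rw [← (Equiv.addRight (1 : ℤ)).hasSum_iff] at h
      convert! h using 1
      · funext y
        have he : Complex.exp (Complex.I * k * y) =
            Complex.exp (-(Complex.I * k)) * Complex.exp (Complex.I * k * ((y + 1 : ℤ) : ℂ)) := by
          rw [← Complex.exp_add]; push_cast; ring_nf
        have hc : ((y + d, (1 : Fin 2)) = (y - d, (1 : Fin 2))) ↔ d = 0 := by
          simp; omega
        have e1 : y + d + 1 = y + 1 + d := by ring
        have e2 : y - d + 1 = y + 1 - d := by ring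
        simp only [Function.comp, Equiv.coe_addRight, fibreTerm, densityKernel, hadamardStep, hc,
          he, e1, e2, ← hq, one_ne_zero, if_false, div_eq_mul_inv _ ((Real.sqrt 2 : ℝ) : ℂ)]
        rw [← hs2]
        ring
      · simp only [fibre, FibreState.step, Complex.ofReal_sub, Complex.ofReal_add,
          Complex.ofReal_mul, hdamp, hcs']
        push_cast
        linear_combination (-(1 / 2) * (if d = 0 then 1 else q) * Complex.sin k *
          ((fibre (1 - p) k t).u d + (fibre (1 - p) k t).w d)) * hI
    · obtain ⟨h00, h11, h01, h10⟩ := ih (d - 1)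
      have h := ((h00.sub h01).add (h10.sub h11)).mul_left (q * (1 / 2))
      convert! h using 1
      · funext y
        have hc : ((y + d, (0 : Fin 2)) = (y - d, (1 : Fin 2))) ↔ False := by simp
        have e1 : y + d - 1 = y + (d - 1) := by ring
        have e2 : y - d + 1 = y - (d - 1) := by ring
        simp only [fibreTerm, densityKernel, hadamardStep, hc, e1, e2, ← hq, one_ne_zero,
          if_false, if_true, div_eq_mul_inv _ ((Real.sqrt 2 : ℝ) : ℂ)]
        rw [← hs2]
        ring
      · simp only [fibre, FibreState.step, hq]
        push_cast
        ring
    · obtain ⟨h00, h11, h01, h10⟩ := ih (d + 1)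
      have h := ((h00.add h01).sub (h10.add h11)).mul_left (q * (1 / 2))
      convert! h using 1
      · funext y
        have hc : ((y + d, (1 : Fin 2)) = (y - d, (0 : Fin 2))) ↔ False := by simp
        have e1 : y + d + 1 = y + (d + 1) := by ring
        have e2 : y - d - 1 = y - (d + 1) := by ring
        simp only [fibreTerm, densityKernel, hadamardStep, hc, e1, e2, ← hq, one_ne_zero,
          if_false, if_true, div_eq_mul_inv _ ((Real.sqrt 2 : ℝ) : ℂ)]
        rw [← hs2]
        ring
      · simp only [fibre, FibreState.step, hq]
        push_cast
        ring

lemma hasSum_PsymProb {p : ℝ} (hp0 : 0 ≤ p) (hp1 : p ≤ 1) (k : ℝ) (t : ℕ) :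
    HasSum (fun x : ℤ => (PsymProb p x t : ℂ) * Complex.exp (Complex.I * k * x))
      ((fibre (1 - p) k t).ι 0 : ℂ) := by
  obtain ⟨h00, h11, -, -⟩ := hasSum_fibreTerm p k t 0
  convert! (h00.add h11).mul_left (1 / 2 : ℂ) using 1
  · funext x
    simp only [PsymProb, fibreTerm, Fin.sum_univ_two, add_zero, sub_zero]
    push_cast
    simp only [ofReal_Pdec hp0 hp1]
    ring
  · ring

lemma charSym_eq {p : ℝ} (hp0 : 0 ≤ p) (hp1 : p ≤ 1) (k : ℝ) (t : ℕ) :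
    charSym p k t = ((fibre (1 - p) k t).ι 0 : ℂ) :=
  (hasSum_PsymProb hp0 hp1 k t).tsum_eq

namespace FibreState

/-- All components vanish at relative coordinates beyond `N`. -/
def SupportedIn (S : FibreState) (N : ℤ) : Prop :=
  ∀ d, N < |d| → S.ι d = 0 ∧ S.ζ d = 0 ∧ S.u d = 0 ∧ S.w d = 0

lemma SupportedIn.step {S : FibreState} {N : ℤ} (hS : S.SupportedIn N) (q k : ℝ) :
    (S.step q k).SupportedIn (N + 1) := by
  intro d hd
  have h0 := hS d (by omega)
  have h1 := hS (d - 1) (by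
    rcases abs_cases d with h | h <;> rcases abs_cases (d - 1) with h' | h' <;> omega)
  have h2 := hS (d + 1) (by
    rcases abs_cases d with h | h <;> rcases abs_cases (d + 1) with h' | h' <;> omega)
  simp [FibreState.step, h0, h1, h2]

lemma SupportedIn.summable {S : FibreState} {N : ℤ} (hS : S.SupportedIn N) {g : ℤ → ℝ}
    (hg : ∀ d, S.ι d = 0 → S.ζ d = 0 → S.u d = 0 → S.w d = 0 → g d = 0) : Summable g := by
  refine summable_of_ne_finset_zero (s := Finset.Icc (-N) N) fun d hd => ?_
  obtain ⟨h1, h2, h3, h4⟩ := hS d (by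
    simp only [Finset.mem_Icc, not_and_or, not_le] at hd
    rcases abs_cases d with h | h <;> omega)
  exact hg d h1 h2 h3 h4

/-- The squared Hilbert–Schmidt norm. -/
def energy (S : FibreState) : ℝ := ∑' d, (2 * S.ι d ^ 2 + 2 * S.ζ d ^ 2 + S.u d ^ 2 + S.w d ^ 2)

/-- The energy of `ζ, u, w`, with the weight `α` at the entry `ζ 0`. -/
def oddEnergy (α : ℝ) (S : FibreState) : ℝ :=
  ∑' d, (2 * (if d = 0 then α else 1) * S.ζ d ^ 2 + S.u d ^ 2 + S.w d ^ 2)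

/-- The energy of `ι` away from the origin. -/
def evenEnergy (S : FibreState) : ℝ := ∑' d, (if d = 0 then 0 else S.ι d ^ 2)

lemma tsum_shift_add_sq {S : FibreState} {N : ℤ} (hS : S.SupportedIn N) {f : ℤ → ℝ} (q : ℝ)
    (hf : ∀ d, S.ι d = 0 → S.ζ d = 0 → S.u d = 0 → S.w d = 0 → f d = 0) :
    ∑' d, (f d + (q * (S.ζ (d - 1) - (S.u (d - 1) - S.w (d - 1)) / 2)) ^ 2 +
        (q * (S.ζ (d + 1) + (S.u (d + 1) - S.w (d + 1)) / 2)) ^ 2) =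
      ∑' d, (f d + q ^ 2 * (2 * S.ζ d ^ 2 + (S.u d - S.w d) ^ 2 / 2)) := by
  have s0 : Summable f := hS.summable hf
  have s1 : Summable fun d => (q * (S.ζ d - (S.u d - S.w d) / 2)) ^ 2 :=
    hS.summable fun d _ h2 h3 h4 => by simp [h2, h3, h4]
  have s2 : Summable fun d => (q * (S.ζ d + (S.u d - S.w d) / 2)) ^ 2 :=
    hS.summable fun d _ h2 h3 h4 => by simp [h2, h3, h4]
  have h1 := (Equiv.subRight (1 : ℤ)).hasSum_iff.mpr s1.hasSum
  have h2 := (Equiv.addRight (1 : ℤ)).hasSum_iff.mpr s2.hasSum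
  have h := (s0.hasSum.add h1).add h2
  have h' := (s0.hasSum.add s1.hasSum).add s2.hasSum
  simp only [Function.comp_def, Equiv.subRight_apply, Equiv.coe_addRight] at h
  rw [h.tsum_eq, ← h'.tsum_eq]
  exact tsum_congr fun d => by ring

lemma energy_step_le {S : FibreState} {N : ℤ} (hS : S.SupportedIn N) {q : ℝ} (hq0 : 0 ≤ q)
    (hq1 : q ≤ 1) (k : ℝ) : (S.step q k).energy ≤ S.energy := by
  unfold energy
  simp only [FibreState.step]
  rw [tsum_shift_add_sq hS q (fun d h1 h2 h3 h4 => by simp [h1, h3, h4])]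
  refine Summable.tsum_le_tsum (fun d => ?_)
    (hS.summable fun d h1 h2 h3 h4 => by simp [h1, h2, h3, h4])
    (hS.summable fun d h1 h2 h3 h4 => by simp [h1, h2, h3, h4])
  have hq2 : q ^ 2 ≤ 1 := pow_le_one₀ hq0 hq1
  have hθ : damping q d ^ 2 ≤ 1 := by unfold damping; split_ifs <;> simp [hq2]
  have hcs := Real.sin_sq_add_cos_sq k
  calc _ = damping q d ^ 2 * (2 * (S.ι d ^ 2 + ((S.u d + S.w d) / 2) ^ 2)) +
        q ^ 2 * (2 * S.ζ d ^ 2 + (S.u d - S.w d) ^ 2 / 2) := by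
        linear_combination
          2 * damping q d ^ 2 * (S.ι d ^ 2 + ((S.u d + S.w d) / 2) ^ 2) * hcs
    _ ≤ 1 * (2 * (S.ι d ^ 2 + ((S.u d + S.w d) / 2) ^ 2)) +
        1 * (2 * S.ζ d ^ 2 + (S.u d - S.w d) ^ 2 / 2) := by gcongr
    _ = _ := by ring

lemma sq_add_le {c s x y ε : ℝ} (hε : 0 < ε) (hc : c ^ 2 ≤ 1) :
    (c * x + s * y) ^ 2 ≤ (1 + ε) * x ^ 2 + (1 + 1 / ε) * (s ^ 2 * y ^ 2) := by
  have h : 0 ≤ (ε * (c * x) - s * y) ^ 2 / ε := by positivity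
  have h2 : (ε * (c * x) - s * y) ^ 2 / ε =
      ε * (c ^ 2 * x ^ 2) - 2 * (c * x) * (s * y) + 1 / ε * (s ^ 2 * y ^ 2) := by
    field_simp
    ring
  have h3 : (1 + ε) * (c ^ 2 * x ^ 2) ≤ (1 + ε) * (1 * x ^ 2) := by gcongr
  nlinarith

lemma oddEnergy_step_le {S : FibreState} {N : ℤ} (hS : S.SupportedIn N) {q α ε : ℝ} (hq0 : 0 ≤ q)
    (hqα : q ≤ α) (hα : α ≤ 1) (hε : 0 < ε) (k : ℝ) :
    (S.step q k).oddEnergy α ≤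
      (1 + ε) * α * S.oddEnergy α + (1 + 1 / ε) * Real.sin k ^ 2 * S.energy := by
  have hα0 : 0 ≤ α := hq0.trans hqα
  have hqq : q ^ 2 ≤ α ^ 2 := by gcongr
  have hαα : α ^ 2 ≤ α := by nlinarith
  have hsum1 : Summable fun d => (2 * (if d = 0 then α else 1) * S.ζ d ^ 2 + S.u d ^ 2 + S.w d ^ 2) :=
    hS.summable fun d h1 h2 h3 h4 => by simp [h2, h3, h4]
  have hsum2 : Summable fun d => (2 * S.ι d ^ 2 + 2 * S.ζ d ^ 2 + S.u d ^ 2 + S.w d ^ 2) :=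
    hS.summable fun d h1 h2 h3 h4 => by simp [h1, h2, h3, h4]
  unfold energy oddEnergy
  simp only [FibreState.step]
  rw [tsum_shift_add_sq hS q (fun d h1 h2 h3 h4 => by simp [h1, h3, h4]), ← tsum_mul_left,
    ← tsum_mul_left, ← (hsum1.mul_left _).tsum_add (hsum2.mul_left _)]
  refine Summable.tsum_le_tsum (fun d => ?_)
    (hS.summable fun d h1 h2 h3 h4 => by simp [h1, h2, h3, h4])
    ((hsum1.mul_left _).add (hsum2.mul_left _))
  have h := sq_add_le (s := Real.sin k) (x := (S.u d + S.w d) / 2) (y := S.ι d) hε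
    (Real.cos_sq_le_one k)
  have hx : q ^ 2 * (2 * S.ζ d ^ 2 + (S.u d - S.w d) ^ 2 / 2) ≤
      (1 + ε) * α * (2 * α * S.ζ d ^ 2 + (S.u d - S.w d) ^ 2 / 2) := by
    have e1 : q ^ 2 * (2 * S.ζ d ^ 2) ≤ 1 * α ^ 2 * (2 * S.ζ d ^ 2) := by
      rw [one_mul]; gcongr
    have e2 : 1 * α ^ 2 * (2 * S.ζ d ^ 2) ≤ (1 + ε) * α ^ 2 * (2 * S.ζ d ^ 2) := by
      gcongr; linarith
    have e3 : q ^ 2 * ((S.u d - S.w d) ^ 2 / 2) ≤ 1 * α * ((S.u d - S.w d) ^ 2 / 2) := by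
      rw [one_mul]; gcongr; linarith
    have e4 : 1 * α * ((S.u d - S.w d) ^ 2 / 2) ≤ (1 + ε) * α * ((S.u d - S.w d) ^ 2 / 2) := by
      gcongr; linarith
    linarith
  set Y := (1 + 1 / ε) * (Real.sin k ^ 2 * S.ι d ^ 2) with hY
  have hY0 : 0 ≤ Y := by positivity
  have hE : 2 * Y ≤ (1 + 1 / ε) * Real.sin k ^ 2 *
      (2 * S.ι d ^ 2 + 2 * S.ζ d ^ 2 + S.u d ^ 2 + S.w d ^ 2) := by
    rw [hY]
    have : 0 ≤ (1 + 1 / ε) * Real.sin k ^ 2 * (2 * S.ζ d ^ 2 + S.u d ^ 2 + S.w d ^ 2) := by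
      positivity
    linarith
  have hX0 : 0 ≤ (1 + ε) * ((S.u d + S.w d) / 2) ^ 2 := by positivity
  have hζ0 : 0 ≤ (1 + ε) * α * ((1 - α) * S.ζ d ^ 2) :=
    mul_nonneg (by positivity) (mul_nonneg (by linarith) (sq_nonneg _))
  by_cases hd : d = 0
  · subst hd
    simp only [damping, if_true, one_mul]
    have h1 := mul_le_mul_of_nonneg_left h (show 0 ≤ 2 * α by linarith)
    have h2 : 2 * α * Y ≤ 2 * Y := by nlinarith
    linarith
  · simp only [damping, if_neg hd]
    have h1 := mul_le_mul_of_nonneg_left h (show 0 ≤ 2 * q ^ 2 by positivity)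
    have h2 : 2 * q ^ 2 * Y ≤ 2 * Y := by nlinarith
    have h3 : q ^ 2 * ((1 + ε) * ((S.u d + S.w d) / 2) ^ 2) ≤
        α * ((1 + ε) * ((S.u d + S.w d) / 2) ^ 2) := by gcongr; linarith
    linarith

lemma evenEnergy_step_le {S : FibreState} {N : ℤ} (hS : S.SupportedIn N) {q α ε : ℝ}
    (hq0 : 0 ≤ q) (hqα : q ≤ α) (hα : α ≤ 1) (hε : 0 < ε) (k : ℝ) :
    (S.step q k).evenEnergy ≤
      (1 + ε) * α * S.evenEnergy + (1 + 1 / ε) * Real.sin k ^ 2 * S.oddEnergy α := by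
  have hα0 : 0 ≤ α := hq0.trans hqα
  have hqq : q ^ 2 ≤ α ^ 2 := by gcongr
  have hαα : α ^ 2 ≤ α := by nlinarith
  have hsum1 : Summable fun d => (2 * (if d = 0 then α else 1) * S.ζ d ^ 2 + S.u d ^ 2 + S.w d ^ 2) :=
    hS.summable fun d h1 h2 h3 h4 => by simp [h2, h3, h4]
  have hsum2 : Summable fun d => (if d = 0 then 0 else S.ι d ^ 2) :=
    hS.summable fun d h1 h2 h3 h4 => by simp [h1]
  unfold evenEnergy oddEnergy
  simp only [FibreState.step]
  rw [← tsum_mul_left, ← tsum_mul_left, ← (hsum2.mul_left _).tsum_add (hsum1.mul_left _)]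
  refine Summable.tsum_le_tsum (fun d => ?_)
    (hS.summable fun d h1 h2 h3 h4 => by simp [h1, h3, h4])
    ((hsum2.mul_left _).add (hsum1.mul_left _))
  by_cases hd : d = 0
  · subst hd
    simp only [if_true, mul_zero, zero_add]
    positivity
  · simp only [damping, if_neg hd, mul_one]
    have h := sq_add_le (s := -Real.sin k) (x := S.ι d) (y := (S.u d + S.w d) / 2) hε
      (Real.cos_sq_le_one k)
    have h1 := mul_le_mul_of_nonneg_left h (show 0 ≤ q ^ 2 by positivity)
    have h2 : q ^ 2 * ((1 + ε) * S.ι d ^ 2) ≤ α * ((1 + ε) * S.ι d ^ 2) := by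
      gcongr; linarith
    have h3 : q ^ 2 * ((1 + 1 / ε) * (Real.sin k ^ 2 * ((S.u d + S.w d) / 2) ^ 2)) ≤
        1 * ((1 + 1 / ε) * (Real.sin k ^ 2 *
          (2 * S.ζ d ^ 2 + S.u d ^ 2 + S.w d ^ 2))) := by
      gcongr
      · linarith
      · nlinarith [sq_nonneg (S.u d - S.w d), sq_nonneg (S.u d + S.w d), sq_nonneg (S.ζ d)]
    rw [neg_sq] at h1
    linarith

end FibreState

lemma supportedIn_fibre (q k : ℝ) (t : ℕ) : (fibre q k t).SupportedIn t := by
  induction t with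
  | zero =>
    intro d hd
    have : d ≠ 0 := by rintro rfl; simp at hd
    simp [fibre, this]
  | succ t ih => simpa [fibre] using ih.step q k

lemma energy_fibre_le {q : ℝ} (hq0 : 0 ≤ q) (hq1 : q ≤ 1) (k : ℝ) (t : ℕ) :
    (fibre q k t).energy ≤ 2 := by
  induction t with
  | zero => simp [FibreState.energy, fibre]
  | succ t ih => exact (FibreState.energy_step_le (supportedIn_fibre q k t) hq0 hq1 k).trans ih

lemma le_div_one_sub_of_le_mul_add {x : ℕ → ℝ} {ρ b : ℝ} (hρ0 : 0 ≤ ρ) (hρ1 : ρ < 1) (hb : 0 ≤ b)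
    (h0 : x 0 = 0) (h : ∀ t, x (t + 1) ≤ ρ * x t + b) (t : ℕ) : x t ≤ b / (1 - ρ) := by
  have h1 : 0 < 1 - ρ := by linarith
  induction t with
  | zero => rw [h0]; positivity
  | succ t ih =>
    calc x (t + 1) ≤ ρ * (b / (1 - ρ)) + b := (h t).trans (by gcongr)
      _ = b / (1 - ρ) := by field_simp; ring

/-- Uniformly in time, the components `ζ, u, w` are of order `sin k` and the off-origin part of
`ι` is of order `sin² k`. -/
lemma exists_fibre_bound {q : ℝ} (hq0 : 0 ≤ q) (hq1 : q < 1) :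
    ∃ K : ℝ, 0 ≤ K ∧ ∀ (k : ℝ) (t : ℕ) (d : ℤ),
      |(fibre q k t).ι 0| ≤ 1 ∧
      |(fibre q k t).ζ d| ≤ K * |Real.sin k| ∧ |(fibre q k t).u d| ≤ K * |Real.sin k| ∧
      |(fibre q k t).w d| ≤ K * |Real.sin k| ∧
      (d ≠ 0 → |(fibre q k t).ι d| ≤ K * Real.sin k ^ 2) := by
  set α : ℝ := (1 + q) / 2 with hα
  set ε : ℝ := (1 - q) / 2 with hε
  set ρ : ℝ := (1 + ε) * α with hρ
  set M : ℝ := (1 + 1 / ε) * 2 / (1 - ρ) with hM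
  have hε0 : 0 < ε := by rw [hε]; linarith
  have hρ0 : 0 ≤ ρ := by positivity
  have hρ1 : ρ < 1 := by rw [hρ, hα, hε]; nlinarith
  have h1ρ : 0 < 1 - ρ := by linarith
  have hM0 : 0 ≤ M := by positivity
  have hodd : ∀ k t, (fibre q k t).oddEnergy α ≤ M * Real.sin k ^ 2 := by
    intro k t
    have h := le_div_one_sub_of_le_mul_add (x := fun t => (fibre q k t).oddEnergy α)
      (b := (1 + 1 / ε) * Real.sin k ^ 2 * 2) hρ0 hρ1 (by positivity)
      (by simp [FibreState.oddEnergy, fibre]) (fun t => ?_) t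
    · refine h.trans (le_of_eq ?_)
      rw [hM]; ring
    · refine (FibreState.oddEnergy_step_le (α := α) (supportedIn_fibre q k t) hq0
        (by rw [hα]; linarith) (by rw [hα]; linarith) hε0 k).trans ?_
      gcongr
      exact energy_fibre_le hq0 hq1.le k t
  have heven : ∀ k t, (fibre q k t).evenEnergy ≤ M ^ 2 * Real.sin k ^ 4 := by
    intro k t
    have h := le_div_one_sub_of_le_mul_add (x := fun t => (fibre q k t).evenEnergy)
      (b := (1 + 1 / ε) * Real.sin k ^ 2 * (M * Real.sin k ^ 2)) hρ0 hρ1 (by positivity)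
      (by
        refine (tsum_congr fun d => ?_).trans tsum_zero
        by_cases hd : d = 0 <;> simp [fibre, hd]) (fun t => ?_) t
    · refine h.trans ?_
      have : (1 + 1 / ε) * Real.sin k ^ 2 * (M * Real.sin k ^ 2) / (1 - ρ) =
        M ^ 2 * Real.sin k ^ 4 / 2 := by
        rw [hM]; field_simp
      rw [this]
      have : 0 ≤ M ^ 2 * Real.sin k ^ 4 := by positivity
      linarith
    · refine (FibreState.evenEnergy_step_le (α := α) (supportedIn_fibre q k t) hq0
        (by rw [hα]; linarith) (by rw [hα]; linarith) hε0 k).trans ?_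
      gcongr
      exact hodd k t
  refine ⟨1 + M, by positivity, fun k t d => ?_⟩
  have hS := supportedIn_fibre q k t
  have hι0 : (fibre q k t).ι 0 ^ 2 ≤ 1 := by
    have h := (hS.summable (g := fun d => (2 * (fibre q k t).ι d ^ 2 + 2 * (fibre q k t).ζ d ^ 2 +
      (fibre q k t).u d ^ 2 + (fibre q k t).w d ^ 2))
      fun d h1 h2 h3 h4 => by simp [h1, h2, h3, h4]).le_tsum 0 (fun d _ => by positivity)
    have h2 := h.trans (energy_fibre_le hq0 hq1.le k t)
    nlinarith [sq_nonneg ((fibre q k t).ζ 0), sq_nonneg ((fibre q k t).u 0),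
      sq_nonneg ((fibre q k t).w 0)]
  have hα2 : 1 ≤ 2 * (if d = 0 then α else 1) := by
    split_ifs
    · rw [hα]; linarith
    · norm_num
  have ho : 2 * (if d = 0 then α else 1) * (fibre q k t).ζ d ^ 2 +
      (fibre q k t).u d ^ 2 + (fibre q k t).w d ^ 2 ≤ M * Real.sin k ^ 2 := by
    refine ((hS.summable (g := fun d => 2 * (if d = 0 then α else 1) * (fibre q k t).ζ d ^ 2 +
      (fibre q k t).u d ^ 2 + (fibre q k t).w d ^ 2)
      fun d h1 h2 h3 h4 => by simp [h2, h3, h4]).le_tsum d (fun d _ => ?_)).trans (hodd k t)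
    positivity
  have hMs : M * Real.sin k ^ 2 ≤ ((1 + M) * |Real.sin k|) ^ 2 := by
    rw [mul_pow, sq_abs]
    gcongr
    nlinarith
  have hζ : (fibre q k t).ζ d ^ 2 ≤
      2 * (if d = 0 then α else 1) * (fibre q k t).ζ d ^ 2 := by
    nlinarith [sq_nonneg ((fibre q k t).ζ d)]
  have hK : 0 ≤ (1 + M) * |Real.sin k| := by positivity
  refine ⟨by simpa using hι0, ?_, ?_, ?_, fun hd => ?_⟩
  · exact abs_le_of_sq_le_sq
      (by nlinarith [sq_nonneg ((fibre q k t).u d), sq_nonneg ((fibre q k t).w d)]) hK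
  · exact abs_le_of_sq_le_sq
      (by nlinarith [sq_nonneg ((fibre q k t).ζ d), sq_nonneg ((fibre q k t).w d)]) hK
  · exact abs_le_of_sq_le_sq
      (by nlinarith [sq_nonneg ((fibre q k t).u d), sq_nonneg ((fibre q k t).ζ d)]) hK
  · have h := ((hS.summable (g := fun d => if d = 0 then 0 else (fibre q k t).ι d ^ 2)
      fun d h1 h2 h3 h4 => by simp [h1]).le_tsum d
      (fun d _ => by positivity)).trans (heven k t)
    rw [if_neg hd] at h
    refine abs_le_of_sq_le_sq (h.trans ?_) (by positivity)
    have : M ^ 2 ≤ (1 + M) ^ 2 := by gcongr; linarith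
    calc M ^ 2 * Real.sin k ^ 4 ≤ (1 + M) ^ 2 * Real.sin k ^ 4 := by gcongr
      _ = _ := by ring

/-- The weight of the corrector functional on `u`; its weight on `w` is the reflection of this. -/
def corrWeight (q : ℝ) (d : ℤ) : ℝ :=
  if 1 ≤ d then q / (2 * (1 - q) * (√(1 + q ^ 2) + 1)) *
    (-(q * (√(1 + q ^ 2) - q) / (√(1 + q ^ 2) + 1))) ^ (d - 1).toNat
  else (1 / 2 + q ^ 2 / (2 * (1 - q) * (√(1 + q ^ 2) + 1))) *
    (-(q * (√(1 + q ^ 2) - q) / (√(1 + q ^ 2) + 1))) ^ (-d).toNat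

/-- The weight of the corrector functional on `ζ`. -/
def corrWeightDiag (q : ℝ) (d : ℤ) : ℝ := q * (corrWeight q (d + 1) + corrWeight q (1 - d))

lemma corrWeightDiag_zero {q : ℝ} (hq1 : q < 1) :
    corrWeightDiag q 0 = (√(1 + q ^ 2) - 1) / (1 - q) := by
  have hR := Real.sq_sqrt (show 0 ≤ 1 + q ^ 2 by positivity)
  have hR0 := Real.sqrt_nonneg (1 + q ^ 2)
  have h1 : 1 - q ≠ 0 := by linarith
  simp only [corrWeightDiag, corrWeight]
  norm_num
  generalize √(1 + q ^ 2) = R at *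
  have h2 : R + 1 ≠ 0 := by linarith
  field_simp
  linear_combination -(2 : ℝ) * hR

lemma corrWeight_coeff_right {q R : ℝ} (h1 : 1 - q ≠ 0) (h2 : R + 1 ≠ 0)
    (hR : R ^ 2 = 1 + q ^ 2) :
    q ^ 2 * (q / (2 * (1 - q) * (R + 1)) * (-(q * (R - q) / (R + 1))) +
        (1 / 2 + q ^ 2 / (2 * (1 - q) * (R + 1)))) / 2 -
      q * (q / (2 * (1 - q) * (R + 1)) * (-(q * (R - q) / (R + 1)))) / 2 +
      q * (1 / 2 + q ^ 2 / (2 * (1 - q) * (R + 1))) / 2 = q / (2 * (1 - q) * (R + 1)) := by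
  field_simp
  linear_combination (q - q ^ 3) * hR

lemma corrWeight_coeff_left {q R : ℝ} (h1 : 1 - q ≠ 0) (h2 : R + 1 ≠ 0)
    (hR : R ^ 2 = 1 + q ^ 2) :
    q ^ 2 * (q / (2 * (1 - q) * (R + 1)) * (-(q * (R - q) / (R + 1))) +
        (1 / 2 + q ^ 2 / (2 * (1 - q) * (R + 1)))) / 2 -
      q * (1 / 2 + q ^ 2 / (2 * (1 - q) * (R + 1))) / 2 +
      q * (q / (2 * (1 - q) * (R + 1)) * (-(q * (R - q) / (R + 1)))) / 2 =
      (1 / 2 + q ^ 2 / (2 * (1 - q) * (R + 1))) * (-(q * (R - q) / (R + 1))) := by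
  field_simp
  linear_combination q * (1 + q) * (1 - q) * hR

lemma corrWeight_eq {q : ℝ} (hq1 : q < 1) (d : ℤ) :
    corrWeightDiag q d * damping q d / 2 - q * corrWeight q (d + 1) / 2 +
      q * corrWeight q (1 - d) / 2 = corrWeight q d - (if d = 0 then 1 / 2 else 0) := by
  have hR := Real.sq_sqrt (show 0 ≤ 1 + q ^ 2 by positivity)
  have hR0 := Real.sqrt_nonneg (1 + q ^ 2)
  have h1 : 1 - q ≠ 0 := by linarith
  have h2 : √(1 + q ^ 2) + 1 ≠ 0 := by linarith
  simp only [corrWeightDiag, corrWeight, damping]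
  rcases lt_trichotomy d 0 with hd | rfl | hd
  · obtain ⟨n, rfl⟩ : ∃ n : ℕ, d = -((n : ℤ) + 1) := ⟨(-d - 1).toNat, by omega⟩
    have e1 : (-(-((n : ℤ) + 1))).toNat = n + 1 := by omega
    have e2 : (-(-((n : ℤ) + 1) + 1)).toNat = n := by omega
    have e3 : (1 - -((n : ℤ) + 1) - 1).toNat = n + 1 := by omega
    rw [if_neg (by omega), if_pos (by omega), if_neg (by omega), if_neg (by omega),
      if_neg (by omega), e1, e2, e3]
    linear_combination
      (-(q * (√(1 + q ^ 2) - q) / (√(1 + q ^ 2) + 1))) ^ n * corrWeight_coeff_left h1 h2 hR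
  · norm_num
    generalize √(1 + q ^ 2) = R at *
    field_simp
    ring
  · obtain ⟨n, rfl⟩ : ∃ n : ℕ, d = (n : ℤ) + 1 := ⟨(d - 1).toNat, by omega⟩
    have e1 : ((n : ℤ) + 1 - 1).toNat = n := by omega
    have e2 : ((n : ℤ) + 1 + 1 - 1).toNat = n + 1 := by omega
    have e3 : (-(1 - ((n : ℤ) + 1))).toNat = n := by omega
    rw [if_pos (by omega), if_neg (by omega), if_neg (by omega), if_pos (by omega),
      if_neg (by omega), e1, e2, e3]
    linear_combination
      (-(q * (√(1 + q ^ 2) - q) / (√(1 + q ^ 2) + 1))) ^ n * corrWeight_coeff_right h1 h2 hR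

lemma summable_abs_corrWeight {q : ℝ} (hq0 : 0 ≤ q) :
    Summable fun d => |corrWeight q d| := by
  have hR0 := Real.sqrt_nonneg (1 + q ^ 2)
  have hqR : q ≤ √(1 + q ^ 2) := Real.le_sqrt_of_sq_le (by linarith)
  have hR1 : √(1 + q ^ 2) ≤ 1 + q := Real.sqrt_le_iff.mpr ⟨by linarith, by nlinarith⟩
  have hR2 : q < √(1 + q ^ 2) + 1 := by linarith
  have hlt : |-(q * (√(1 + q ^ 2) - q) / (√(1 + q ^ 2) + 1))| < 1 := by
    rw [abs_neg, abs_of_nonneg (div_nonneg (mul_nonneg hq0 (by linarith)) (by linarith)),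
      div_lt_one (by linarith)]
    nlinarith
  have hgeo := summable_geometric_of_lt_one (abs_nonneg _) hlt
  refine Summable.of_nat_of_neg ?_ ?_
  · rw [← summable_nat_add_iff 1]
    refine (hgeo.mul_left |q / (2 * (1 - q) * (√(1 + q ^ 2) + 1))|).congr fun n => ?_
    simp only [corrWeight]
    rw [if_pos (by omega), abs_mul, abs_pow,
      show (((n + 1 : ℕ) : ℤ) - 1).toNat = n by omega]
  · refine (hgeo.mul_left |1 / 2 + q ^ 2 / (2 * (1 - q) * (√(1 + q ^ 2) + 1))|).congr fun n => ?_
    simp only [corrWeight]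
    rw [if_neg (by omega), abs_mul, abs_pow, show (-(-(n : ℤ))).toNat = n by omega]

lemma summable_abs_corrWeight_reflect {q : ℝ} (hq0 : 0 ≤ q) :
    Summable fun d => |corrWeight q (-d)| :=
  (Equiv.neg ℤ).summable_iff.mpr (summable_abs_corrWeight hq0)

lemma summable_abs_corrWeightDiag {q : ℝ} (hq0 : 0 ≤ q) :
    Summable fun d => |corrWeightDiag q d| := by
  have h1 := (Equiv.addRight (1 : ℤ)).summable_iff.mpr (summable_abs_corrWeight hq0)
  have h2 := (Equiv.subLeft (1 : ℤ)).summable_iff.mpr (summable_abs_corrWeight hq0)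
  refine ((h1.add h2).mul_left q).of_nonneg_of_le (fun d => abs_nonneg _) fun d => ?_
  rw [corrWeightDiag, abs_mul, abs_of_nonneg hq0]
  gcongr
  exact abs_add_le _ _

namespace FibreState

/-- The corrector functional: a left solution of the Poisson equation for the walk at momentum
zero. -/
def corr (q : ℝ) (S : FibreState) : ℝ :=
  ∑' d, (corrWeightDiag q d * S.ζ d + corrWeight q d * S.u d + corrWeight q (-d) * S.w d)

lemma corr_step {S : FibreState} {N : ℤ} (hS : S.SupportedIn N) {q : ℝ} (hq1 : q < 1) (k : ℝ) :
    (S.step q k).corr q = S.corr q - (S.u 0 + S.w 0) / 2 +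
      Real.sin k * ∑' d, corrWeightDiag q d * damping q d * S.ι d +
      (Real.cos k - 1) * ∑' d, corrWeightDiag q d * damping q d * ((S.u d + S.w d) / 2) := by
  have s1 : Summable fun d => corrWeight q (d + 1) * (q * (S.ζ d - (S.u d - S.w d) / 2)) :=
    hS.summable fun d _ h2 h3 h4 => by simp [h2, h3, h4]
  have s2 : Summable fun d => corrWeight q (-(d - 1)) * (q * (S.ζ d + (S.u d - S.w d) / 2)) :=
    hS.summable fun d _ h2 h3 h4 => by simp [h2, h3, h4]
  have s3 : Summable fun d => corrWeightDiag q d * damping q d * S.ι d :=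
    hS.summable fun d h1 h2 h3 h4 => by simp [h1]
  have s4 : Summable fun d => corrWeightDiag q d * damping q d * ((S.u d + S.w d) / 2) :=
    hS.summable fun d h1 h2 h3 h4 => by simp [h3, h4]
  have s5 : Summable fun d => (corrWeightDiag q d * S.ζ d + corrWeight q d * S.u d +
      corrWeight q (-d) * S.w d) :=
    hS.summable fun d h1 h2 h3 h4 => by simp [h2, h3, h4]
  have h1 := (Equiv.subRight (1 : ℤ)).hasSum_iff.mpr s1.hasSum
  have h2 := (Equiv.addRight (1 : ℤ)).hasSum_iff.mpr s2.hasSum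
  have h3 := s3.hasSum.mul_left (Real.sin k)
  have h4 := s4.hasSum.mul_left (Real.cos k)
  have hδ := hasSum_ite_eq (0 : ℤ) ((S.u 0 + S.w 0) / 2)
  have hlhs := ((h3.add h4).add h1).add h2
  have hrhs := ((s5.hasSum.sub hδ).add h3).add (s4.hasSum.mul_left (Real.cos k - 1))
  have hsum := (h3.add h4).add (s1.hasSum.add s2.hasSum)
  have hkey : (fun d => Real.sin k * (corrWeightDiag q d * damping q d * S.ι d) +
      Real.cos k * (corrWeightDiag q d * damping q d * ((S.u d + S.w d) / 2)) +
      (corrWeight q (d + 1) * (q * (S.ζ d - (S.u d - S.w d) / 2)) +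
        corrWeight q (-(d - 1)) * (q * (S.ζ d + (S.u d - S.w d) / 2)))) =
      fun d => corrWeightDiag q d * S.ζ d + corrWeight q d * S.u d + corrWeight q (-d) * S.w d -
        (if d = 0 then (S.u 0 + S.w 0) / 2 else 0) +
        Real.sin k * (corrWeightDiag q d * damping q d * S.ι d) +
        (Real.cos k - 1) * (corrWeightDiag q d * damping q d * ((S.u d + S.w d) / 2)) := by
    funext d
    have e1 := corrWeight_eq hq1 d
    have e2 := corrWeight_eq hq1 (-d)
    have e3 : damping q (-d) = damping q d := by simp [damping]
    have e4 : corrWeightDiag q (-d) = corrWeightDiag q d := by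
      simp only [corrWeightDiag]
      rw [add_comm, sub_neg_eq_add, add_comm 1 d, neg_add_eq_sub]
    have e5 : -d + 1 = 1 - d := by ring
    have e6 : -(d - 1) = 1 - d := by ring
    have e7 : 1 - -d = d + 1 := by ring
    have e8 : (if d = 0 then (S.u 0 + S.w 0) / 2 else 0) =
      (if d = 0 then 1 / 2 else 0) * S.u d + (if -d = 0 then 1 / 2 else 0) * S.w d := by
      by_cases hd : d = 0
      · subst hd; simp; ring
      · simp [hd]
    rw [e3, e4, e5, e7] at e2
    rw [e6, e8]
    have e9 : corrWeightDiag q d = q * (corrWeight q (d + 1) + corrWeight q (1 - d)) := rfl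
    linear_combination S.u d * e1 + S.w d * e2 - S.ζ d * e9
  rw [hkey] at hsum
  have huniq := hrhs.unique hsum
  have hcorr : (S.step q k).corr q = _ := Eq.trans (tsum_congr fun d => by
    simp only [FibreState.step, Function.comp, Equiv.subRight_apply, Equiv.coe_addRight,
      sub_add_cancel, add_sub_cancel_right]
    ring) hlhs.tsum_eq
  rw [hcorr, corr]
  linarith

end FibreState

lemma abs_tsum_mul_le {a f : ℤ → ℝ} {Y : ℝ} (ha : Summable fun d => |a d|)
    (hf : ∀ d, |f d| ≤ Y) : |∑' d, a d * f d| ≤ (∑' d, |a d|) * Y := by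
  refine tsum_of_norm_bounded (f := fun d => a d * f d) (ha.hasSum.mul_right Y) fun d => ?_
  rw [Real.norm_eq_abs, abs_mul]
  exact mul_le_mul_of_nonneg_left (hf d) (abs_nonneg _)

lemma abs_cos_sub_exp_le {σ k : ℝ} (hσ : 0 ≤ σ) (hk : |k| ≤ 1) :
    |Real.cos k - Real.sin k ^ 2 * σ - Real.exp (-((1 + 2 * σ) / 2 * k ^ 2))| ≤
      (1 + 2 * σ + ((1 + 2 * σ) / 2) ^ 2) * k ^ 4 := by
  have hk4 : |k| ^ 4 = k ^ 4 := by rw [← abs_pow, abs_of_nonneg (by positivity)]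
  have hcos := abs_le.mp (Real.cos_bound hk)
  have hsin : |k ^ 2 - Real.sin k ^ 2| ≤ 2 * k ^ 4 := by
    have h1 : |Real.sin k - k| ≤ |k| ^ 3 := by
      have h2 := Real.sin_bound hk
      have h3 : |k| ^ 5 ≤ |k| ^ 3 := pow_le_pow_of_le_one (abs_nonneg _) hk (by norm_num)
      have h4 : |Real.sin k - k| ≤ |Real.sin k - (k - k ^ 3 / 6)| + |-(k ^ 3 / 6)| := by
        rw [show Real.sin k - k = Real.sin k - (k - k ^ 3 / 6) + -(k ^ 3 / 6) by ring]
        exact abs_add_le _ _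
      rw [abs_neg, abs_div, abs_pow, abs_of_nonneg (show (0 : ℝ) ≤ 6 by norm_num)] at h4
      linarith [pow_nonneg (abs_nonneg k) 3]
    have h2 : |Real.sin k + k| ≤ 2 * |k| := by
      linarith [abs_add_le (Real.sin k) k, Real.abs_sin_le_abs (x := k)]
    calc |k ^ 2 - Real.sin k ^ 2| = |Real.sin k - k| * |Real.sin k + k| := by
          rw [← abs_mul, ← abs_neg]; ring_nf
      _ ≤ |k| ^ 3 * (2 * |k|) := mul_le_mul h1 h2 (abs_nonneg _) (by positivity)
      _ = 2 * k ^ 4 := by rw [← hk4]; ring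
  have hsin' := abs_le.mp hsin
  have hx : 0 ≤ (1 + 2 * σ) / 2 * k ^ 2 := by positivity
  generalize hxe : (1 + 2 * σ) / 2 * k ^ 2 = x at hx
  have hexp1 : 1 - x ≤ Real.exp (-x) := by linarith [Real.add_one_le_exp (-x)]
  have hexp2 : Real.exp (-x) ≤ 1 - x + x ^ 2 := by
    rw [Real.exp_neg, inv_le_comm₀ (Real.exp_pos _) (by nlinarith [sq_nonneg (x - 1)])]
    refine le_trans ?_ (Real.add_one_le_exp x)
    rw [inv_le_iff_one_le_mul₀ (by nlinarith [sq_nonneg (x - 1)])]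
    nlinarith [pow_nonneg hx 3]
  have hx2 : x ^ 2 = ((1 + 2 * σ) / 2) ^ 2 * k ^ 4 := by rw [← hxe]; ring
  have hs1 := mul_le_mul_of_nonneg_right hsin'.1 hσ
  have hs2 := mul_le_mul_of_nonneg_right hsin'.2 hσ
  have hk0 : 0 ≤ k ^ 4 := by positivity
  rw [hk4] at hcos
  rw [abs_le]
  constructor <;> nlinarith [mul_nonneg hσ hk0]

lemma damping_mem_Icc {q : ℝ} (hq0 : 0 ≤ q) (hq1 : q ≤ 1) (d : ℤ) :
    damping q d ∈ Set.Icc (0 : ℝ) 1 := by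
  unfold damping
  split_ifs
  · simp
  · exact ⟨hq0, hq1⟩

lemma abs_damping_mul_le {q : ℝ} (hq0 : 0 ≤ q) (hq1 : q ≤ 1) (d : ℤ) (x : ℝ) :
    |damping q d * x| ≤ |x| := by
  obtain ⟨h0, h1⟩ := damping_mem_Icc hq0 hq1 d
  rw [abs_mul, abs_of_nonneg h0]
  exact mul_le_of_le_one_left (abs_nonneg _) h1

lemma abs_corr_le {q : ℝ} (hq0 : 0 ≤ q) {S : FibreState} {N : ℤ} (hS : S.SupportedIn N) {Y : ℝ}
    (hζ : ∀ d, |S.ζ d| ≤ Y) (hu : ∀ d, |S.u d| ≤ Y) (hw : ∀ d, |S.w d| ≤ Y) :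
    |S.corr q| ≤ (∑' d, |corrWeightDiag q d| + ∑' d, |corrWeight q d| +
      ∑' d, |corrWeight q (-d)|) * Y := by
  have s1 : Summable fun d => corrWeightDiag q d * S.ζ d :=
    hS.summable fun d _ h2 _ _ => by simp [h2]
  have s2 : Summable fun d => corrWeight q d * S.u d :=
    hS.summable fun d _ _ h3 _ => by simp [h3]
  have s3 : Summable fun d => corrWeight q (-d) * S.w d :=
    hS.summable fun d _ _ _ h4 => by simp [h4]
  rw [FibreState.corr, (s1.add s2).tsum_add s3, s1.tsum_add s2]
  refine (abs_add_three _ _ _).trans ?_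
  linarith [abs_tsum_mul_le (summable_abs_corrWeightDiag hq0) hζ,
    abs_tsum_mul_le (summable_abs_corrWeight hq0) hu,
    abs_tsum_mul_le (summable_abs_corrWeight_reflect hq0) hw]

lemma abs_tsum_corrWeightDiag_ι_sub_le {q : ℝ} (hq0 : 0 ≤ q) (hq1 : q ≤ 1) {S : FibreState} {N : ℤ}
    (hS : S.SupportedIn N) {Y : ℝ} (hY : 0 ≤ Y) (hι : ∀ d, d ≠ 0 → |S.ι d| ≤ Y) :
    |∑' d, corrWeightDiag q d * damping q d * S.ι d - corrWeightDiag q 0 * S.ι 0| ≤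
      (∑' d, |corrWeightDiag q d|) * Y := by
  have s : Summable fun d => corrWeightDiag q d * damping q d * S.ι d :=
    hS.summable fun d h1 _ _ _ => by simp [h1]
  have h := s.hasSum.sub (hasSum_ite_eq (0 : ℤ) (corrWeightDiag q 0 * S.ι 0))
  rw [← h.tsum_eq]
  refine le_trans (le_of_eq ?_) (abs_tsum_mul_le
    (f := fun d => if d = 0 then 0 else damping q d * S.ι d) (summable_abs_corrWeightDiag hq0)
    fun d => ?_)
  · congr 2
    funext d
    by_cases hd : d = 0
    · subst hd; simp [damping]
    · simp [hd, mul_assoc]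
  · split_ifs with hd
    · simpa using hY
    · exact (abs_damping_mul_le hq0 hq1 d _).trans (hι d hd)

lemma abs_tsum_corrWeightDiag_uw_le {q : ℝ} (hq0 : 0 ≤ q) (hq1 : q ≤ 1) {S : FibreState} {Y : ℝ}
    (hu : ∀ d, |S.u d| ≤ Y) (hw : ∀ d, |S.w d| ≤ Y) :
    |∑' d, corrWeightDiag q d * damping q d * ((S.u d + S.w d) / 2)| ≤
      (∑' d, |corrWeightDiag q d|) * Y := by
  simp only [mul_assoc]
  refine abs_tsum_mul_le (f := fun d => damping q d * ((S.u d + S.w d) / 2))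
    (summable_abs_corrWeightDiag hq0) fun d => (abs_damping_mul_le hq0 hq1 d _).trans ?_
  rw [abs_div, abs_of_pos (show (0 : ℝ) < 2 by norm_num)]
  linarith [abs_add_le (S.u d) (S.w d), hu d, hw d]

/-- The characteristic function is, up to the corrector, multiplied by a Gaussian factor at each
step. -/
lemma exists_fibre_gaussian_bound {q : ℝ} (hq0 : 0 ≤ q) (hq1 : q < 1) :
    ∃ C > 0, ∀ k : ℝ, |k| ≤ 1 → ∀ t : ℕ,
      |(fibre q k t).ι 0 - Real.exp (-((1 + 2 * corrWeightDiag q 0) / 2 * k ^ 2)) ^ t| ≤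
        C * (t * k ^ 4 + k ^ 2) := by
  obtain ⟨K, hK0, hK⟩ := exists_fibre_bound hq0 hq1
  have hσ : 0 ≤ corrWeightDiag q 0 := by
    rw [corrWeightDiag_zero hq1]
    exact div_nonneg (sub_nonneg.mpr (Real.one_le_sqrt.mpr (by nlinarith))) (by linarith)
  set σ := corrWeightDiag q 0
  set A := ∑' d, |corrWeightDiag q d| + ∑' d, |corrWeight q d| + ∑' d, |corrWeight q (-d)|
  have hA1 : ∑' d, |corrWeightDiag q d| ≤ A := by
    have h1 : 0 ≤ ∑' d, |corrWeight q d| := tsum_nonneg fun d => abs_nonneg _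
    have h2 : 0 ≤ ∑' d, |corrWeight q (-d)| := tsum_nonneg fun d => abs_nonneg _
    linarith
  have hA0 : 0 ≤ A := (tsum_nonneg fun d => abs_nonneg _).trans hA1
  refine ⟨1 + 2 * σ + ((1 + 2 * σ) / 2) ^ 2 + A * K * ((1 + 2 * σ) / 2 + 2), by positivity,
    fun k hk t => ?_⟩
  set M := 1 + 2 * σ + ((1 + 2 * σ) / 2) ^ 2 + A * K * ((1 + 2 * σ) / 2 + 2) with hM
  set E := Real.exp (-((1 + 2 * σ) / 2 * k ^ 2))
  have hx : 0 ≤ (1 + 2 * σ) / 2 * k ^ 2 := by positivity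
  have hE1 : E ≤ 1 := Real.exp_le_one_iff.mpr (by linarith)
  have hE0 : |E - 1| ≤ (1 + 2 * σ) / 2 * k ^ 2 := by
    rw [abs_le]
    constructor <;> linarith [Real.add_one_le_exp (-((1 + 2 * σ) / 2 * k ^ 2))]
  have hs : |Real.sin k| ≤ |k| := Real.abs_sin_le_abs
  have hcos : |Real.cos k - 1| ≤ k ^ 2 := by
    rw [abs_le]
    constructor <;> nlinarith [Real.one_sub_sq_div_two_le_cos (x := k), Real.cos_le_one k]
  have hG : ∀ t, |(fibre q k t).corr q| ≤ A * K * |k| := fun t => by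
    refine (abs_corr_le hq0 (supportedIn_fibre q k t) (fun d => (hK k t d).2.1)
      (fun d => (hK k t d).2.2.1) (fun d => (hK k t d).2.2.2.1)).trans ?_
    rw [mul_assoc]
    gcongr
  have hsG : ∀ t, |Real.sin k * (fibre q k t).corr q| ≤ A * K * k ^ 2 := fun t => by
    rw [abs_mul, ← sq_abs k]
    calc _ ≤ |k| * (A * K * |k|) := mul_le_mul hs (hG t) (abs_nonneg _) (abs_nonneg _)
      _ = _ := by ring
  have hstep : ∀ t, |((fibre q k (t + 1)).ι 0 - Real.sin k * (fibre q k (t + 1)).corr q) -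
      E * ((fibre q k t).ι 0 - Real.sin k * (fibre q k t).corr q)| ≤ M * k ^ 4 := fun t => by
    have hS := supportedIn_fibre q k t
    have h1 : |(Real.cos k - Real.sin k ^ 2 * σ - E) * (fibre q k t).ι 0| ≤
        (1 + 2 * σ + ((1 + 2 * σ) / 2) ^ 2) * k ^ 4 := by
      rw [abs_mul]
      exact (mul_le_of_le_one_right (abs_nonneg _) (hK k t 0).1).trans (abs_cos_sub_exp_le hσ hk)
    have h2 : |(E - 1) * (Real.sin k * (fibre q k t).corr q)| ≤
        (1 + 2 * σ) / 2 * k ^ 2 * (A * K * k ^ 2) := by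
      rw [abs_mul]
      exact mul_le_mul hE0 (hsG t) (abs_nonneg _) hx
    have hs2 : Real.sin k ^ 2 ≤ k ^ 2 := sq_le_sq.mpr hs
    have h3 : |Real.sin k ^ 2 * (∑' d, corrWeightDiag q d * damping q d * (fibre q k t).ι d -
        σ * (fibre q k t).ι 0)| ≤ k ^ 2 * (A * (K * k ^ 2)) := by
      rw [abs_mul, abs_of_nonneg (sq_nonneg _)]
      refine mul_le_mul hs2 ((abs_tsum_corrWeightDiag_ι_sub_le hq0 hq1.le hS (by positivity)
        fun d => (hK k t d).2.2.2.2).trans ?_) (abs_nonneg _) (sq_nonneg _)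
      gcongr
    have h4 : |Real.sin k * ((Real.cos k - 1) * ∑' d, corrWeightDiag q d * damping q d *
        (((fibre q k t).u d + (fibre q k t).w d) / 2))| ≤ |k| * (k ^ 2 * (A * (K * |k|))) := by
      rw [abs_mul, abs_mul]
      refine mul_le_mul hs (mul_le_mul hcos ((abs_tsum_corrWeightDiag_uw_le hq0 hq1.le
        (fun d => (hK k t d).2.2.1) (fun d => (hK k t d).2.2.2.1)).trans ?_) (abs_nonneg _)
        (sq_nonneg _)) (by positivity) (abs_nonneg _)
      gcongr
    have hι : (fibre q k (t + 1)).ι 0 = Real.cos k * (fibre q k t).ι 0 -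
        Real.sin k * (((fibre q k t).u 0 + (fibre q k t).w 0) / 2) := by
      simp [fibre, FibreState.step, damping]
    have hcorr : (fibre q k (t + 1)).corr q = _ := FibreState.corr_step hS hq1 k
    rw [hι, hcorr]
    set X := ∑' d, corrWeightDiag q d * damping q d * (fibre q k t).ι d
    set Z := ∑' d, corrWeightDiag q d * damping q d *
      (((fibre q k t).u d + (fibre q k t).w d) / 2)
    have h4' : |k| * (k ^ 2 * (A * (K * |k|))) = A * K * k ^ 4 := by
      linear_combination (A * K * k ^ 2) * (abs_mul_abs_self k)
    rw [h4'] at h4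
    have hMk : M * k ^ 4 = (1 + 2 * σ + ((1 + 2 * σ) / 2) ^ 2) * k ^ 4 +
        (1 + 2 * σ) / 2 * k ^ 2 * (A * K * k ^ 2) + k ^ 2 * (A * (K * k ^ 2)) + A * K * k ^ 4 := by
      rw [hM]; ring
    rw [hMk]
    rw [abs_le] at h1 h2 h3 h4 ⊢
    constructor <;> linarith
  have hC : |((fibre q k t).ι 0 - Real.sin k * (fibre q k t).corr q) - E ^ t| ≤
      t * (M * k ^ 4) := by
    induction t with
    | zero => simp [fibre, FibreState.corr]
    | succ t ih =>
      calc _ = |(((fibre q k (t + 1)).ι 0 - Real.sin k * (fibre q k (t + 1)).corr q) -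
            E * ((fibre q k t).ι 0 - Real.sin k * (fibre q k t).corr q)) +
            E * (((fibre q k t).ι 0 - Real.sin k * (fibre q k t).corr q) - E ^ t)| := by
            rw [pow_succ]; ring_nf
        _ ≤ M * k ^ 4 + 1 * (t * (M * k ^ 4)) := by
            refine (abs_add_le _ _).trans (add_le_add (hstep t) ?_)
            rw [abs_mul, abs_of_nonneg (Real.exp_pos _).le]
            exact mul_le_mul hE1 ih (abs_nonneg _) zero_le_one
        _ = _ := by push_cast; ring
  have hAK : A * K * k ^ 2 ≤ M * k ^ 2 := by
    refine mul_le_mul_of_nonneg_right ?_ (sq_nonneg _)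
    nlinarith [mul_nonneg hA0 hK0, mul_nonneg (mul_nonneg hA0 hK0) hσ, sq_nonneg ((1 + 2 * σ) / 2)]
  have := hsG t
  rw [abs_le] at this hC ⊢
  constructor <;> nlinarith

open MeasureTheory ProbabilityTheory in
lemma tendsto_integral_gaussianReal_of_charFun {P : ℕ → ℤ → ℝ} (hP0 : ∀ t x, 0 ≤ P t x)
    (hP1 : ∀ t, HasSum (P t) 1) (v : NNReal)
    (h : ∀ k : ℝ, Tendsto (fun t : ℕ => ∑' x : ℤ,
      (P t x : ℂ) * Complex.exp (Complex.I * (k / Real.sqrt t : ℝ) * x)) atTop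
      (nhds (Real.exp (-(v / 2) * k ^ 2) : ℝ)))
    (f : BoundedContinuousFunction ℝ ℝ) :
    Tendsto (fun t : ℕ => ∑' x : ℤ, P t x * f ((x : ℝ) / Real.sqrt t)) atTop
      (nhds (∫ y, f y ∂(gaussianReal 0 v))) := by
  let π : ℕ → PMF ℤ := fun t => ⟨fun x => ENNReal.ofReal (P t x), by
    have hs := (ENNReal.ofReal_tsum_of_nonneg (hP0 t) (hP1 t).summable).symm
    rw [(hP1 t).tsum_eq, ENNReal.ofReal_one] at hs
    exact hs ▸ ENNReal.summable.hasSum⟩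
  have hπ : ∀ t x, (π t x).toReal = P t x := fun t x => ENNReal.toReal_ofReal (hP0 t x)
  have hmeas : ∀ t : ℕ, Measurable fun x : ℤ => (x : ℝ) / Real.sqrt t := fun t =>
    measurable_of_countable _
  let μ : ℕ → ProbabilityMeasure ℝ := fun t =>
    ⟨(π t).toMeasure.map fun x : ℤ => (x : ℝ) / Real.sqrt t,
      Measure.isProbabilityMeasure_map (hmeas t).aemeasurable⟩
  have hμ : Tendsto μ atTop (nhds ⟨gaussianReal 0 v, inferInstance⟩) := by
    refine ProbabilityMeasure.tendsto_iff_tendsto_charFun.mpr fun k => ?_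
    have hk := h k
    have hg : charFun (gaussianReal 0 v) k = (Real.exp (-(v / 2) * k ^ 2) : ℝ) := by
      rw [charFun_gaussianReal]
      push_cast
      ring_nf
    simp only [ProbabilityMeasure.coe_mk, hg]
    refine hk.congr fun t => ?_
    simp only [μ, ProbabilityMeasure.coe_mk]
    rw [charFun_apply_real, integral_map (hmeas t).aemeasurable (by fun_prop), PMF.integral_eq_tsum]
    · refine tsum_congr fun x => ?_
      rw [hπ, Complex.real_smul]
      congr 2
      push_cast
      ring
    · refine Integrable.of_bound (measurable_of_countable _).aestronglyMeasurable 1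
        (Eventually.of_forall fun x => ?_)
      rw [← Complex.ofReal_mul, Complex.norm_exp_ofReal_mul_I]
  have hf := ProbabilityMeasure.tendsto_iff_forall_integral_tendsto.mp hμ f
  refine hf.congr fun t => ?_
  simp only [μ, ProbabilityMeasure.coe_mk]
  rw [integral_map (hmeas t).aemeasurable f.continuous.aestronglyMeasurable, PMF.integral_eq_tsum]
  · simp only [hπ, smul_eq_mul]
  · exact Integrable.of_bound (measurable_of_countable _).aestronglyMeasurable ‖f‖
      (Eventually.of_forall fun x => f.norm_coe_le_norm _)

lemma PsymProb_nonneg (p : ℝ) (x : ℤ) (t : ℕ) : 0 ≤ PsymProb p x t :=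
  mul_nonneg (by norm_num) (Finset.sum_nonneg fun _ _ => Finset.sum_nonneg fun _ _ =>
    tsum_nonneg fun _ => sq_nonneg _)

lemma fibre_zero_ι (q : ℝ) (t : ℕ) : (fibre q 0 t).ι 0 = 1 := by
  induction t with
  | zero => simp [fibre]
  | succ t ih => simp [fibre, FibreState.step, damping, ih]

lemma hasSum_PsymProb_one {p : ℝ} (hp0 : 0 ≤ p) (hp1 : p ≤ 1) (t : ℕ) :
    HasSum (fun x => PsymProb p x t) 1 := by
  have h := hasSum_PsymProb hp0 hp1 0 t
  rw [fibre_zero_ι] at h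
  simpa [← Complex.hasSum_ofReal] using h

/-- CLT for the symmetric decoherent Hadamard walk: with
`v = (p + 2√(1+q²) - 2)/p`, for every fixed `k` one has
`P̂(k/√t, t) = exp(-(v/2)k²) + O(t⁻¹)` as `t → ∞`, and consequently `X_t/√t`
converges in distribution to `N(0, v)`. -/
theorem symmetric_walk_clt (p q : ℝ) (hp0 : 0 < p) (hp1 : p ≤ 1) (hq : q = 1 - p)
    (v : ℝ) (hv : v = (p + 2 * Real.sqrt (1 + q ^ 2) - 2) / p) :
    (∀ k : ℝ, ∃ C > (0 : ℝ), ∃ T : ℕ, ∀ t : ℕ, T ≤ t →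
      ‖charSym p (k / Real.sqrt t) t - ((Real.exp (-(v / 2) * k ^ 2) : ℝ) : ℂ)‖
        ≤ C / (t : ℝ)) ∧
    (∀ f : BoundedContinuousFunction ℝ ℝ,
      Tendsto (fun t : ℕ => ∑' x : ℤ, PsymProb p x t * f ((x : ℝ) / Real.sqrt t))
        atTop
        (nhds (∫ y, f y ∂(ProbabilityTheory.gaussianReal 0 (Real.toNNReal v))))) := by
  have hq0 : 0 ≤ q := by linarith
  have hq1 : q < 1 := by linarith
  have hvσ : v = 1 + 2 * corrWeightDiag q 0 := by
    rw [hv, corrWeightDiag_zero hq1, show p = 1 - q by linarith]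
    have : 1 - q ≠ 0 := by linarith
    field_simp
    ring
  have hv0 : 0 ≤ v := by
    rw [hv]
    have : 1 ≤ Real.sqrt (1 + q ^ 2) := Real.one_le_sqrt.mpr (by nlinarith)
    exact div_nonneg (by linarith) hp0.le
  have hrate : ∀ k : ℝ, ∃ C > (0 : ℝ), ∃ T : ℕ, ∀ t : ℕ, T ≤ t →
      ‖charSym p (k / Real.sqrt t) t - ((Real.exp (-(v / 2) * k ^ 2) : ℝ) : ℂ)‖
        ≤ C / (t : ℝ) := by
    intro k
    obtain ⟨C, hC, h⟩ := exists_fibre_gaussian_bound hq0 hq1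
    obtain ⟨T, hT⟩ := exists_nat_ge (k ^ 2)
    refine ⟨C * (k ^ 4 + k ^ 2 + 1), by positivity, T + 1, fun t ht => ?_⟩
    have ht0 : (0 : ℝ) < t := by exact_mod_cast (by omega : 0 < t)
    have hsq : (k / Real.sqrt t) ^ 2 = k ^ 2 / t := by rw [div_pow, Real.sq_sqrt ht0.le]
    have hk : |k / Real.sqrt t| ≤ 1 := by
      rw [← sq_le_one_iff_abs_le_one, hsq, div_le_one ht0]
      exact hT.trans (by exact_mod_cast (by omega : T ≤ t))
    have hE : Real.exp (-((1 + 2 * corrWeightDiag q 0) / 2 * (k / Real.sqrt t) ^ 2)) ^ t =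
        Real.exp (-(v / 2) * k ^ 2) := by
      rw [← Real.exp_nat_mul, hsq, hvσ]
      congr 1
      field_simp
    have hb := h _ hk t
    rw [hE, show (k / Real.sqrt t) ^ 4 = ((k / Real.sqrt t) ^ 2) ^ 2 by ring, hsq] at hb
    rw [charSym_eq hp0.le hp1, ← hq, ← Complex.ofReal_sub, Complex.norm_real, Real.norm_eq_abs]
    refine hb.trans ?_
    rw [show C * (t * (k ^ 2 / t) ^ 2 + k ^ 2 / t) = C * (k ^ 4 + k ^ 2) / t by field_simp]
    exact div_le_div_of_nonneg_right (mul_le_mul_of_nonneg_left (by linarith) hC.le) ht0.le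
  refine ⟨hrate, fun f => tendsto_integral_gaussianReal_of_charFun
    (fun t x => PsymProb_nonneg p x t) (fun t => hasSum_PsymProb_one hp0.le hp1 t) _
    (fun k => ?_) f⟩
  obtain ⟨C, -, T, h⟩ := hrate k
  rw [Real.coe_toNNReal v hv0, tendsto_iff_norm_sub_tendsto_zero]
  exact squeeze_zero' (Eventually.of_forall fun t => norm_nonneg _)
    (eventually_atTop.mpr ⟨T, h⟩) (tendsto_const_div_atTop_nhds_zero_nat C)

end
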